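/- Let ν be a measure on ℝ such that ∫_{|y|<1} y² ν(dy) < ∞ and ∫_{|y|≥1} |y| ν(dy) < ∞. Then for every τ > 0, σ > 0 and x, k ∈ ℝ, the function y ↦ Bac(τ, x + y, k, σ) − Bac(τ, x, k, σ) − y·Φ(d(x, k, σ, τ)) is ν-integrable, and its ν-integral of absolute values is bounded by (1/(2·√(2π)·σ·√τ))·∫_{|y|<1} y² ν(dy) + 2·∫_{|y|≥1} |y| ν(dy). -/

import Mathlib

open MeasureTheory Filter Set

/-- Standard normal density `φ(z) = e^{-z²/2}/√(2π)`. -/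
noncomputable def stdGaussPdf (z : ℝ) : ℝ := Real.exp (-(z ^ 2) / 2) / Real.sqrt (2 * Real.pi)

/-- Standard normal cumulative distribution function `Φ(z) = ∫_{-∞}^z φ(u) du`. -/
noncomputable def stdGaussCdf (z : ℝ) : ℝ := ∫ u in Set.Iic z, stdGaussPdf u

/-- `d(x, k, σ, τ) = (x − k)/(σ√τ)`. -/
noncomputable def dBac (x k σ τ : ℝ) : ℝ := (x - k) / (σ * Real.sqrt τ)

/-- Bachelier price `Bac(τ, x, k, σ) = (x − k)·Φ(d) + φ(d)·σ·√τ`. -/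
noncomputable def Bac (τ x k σ : ℝ) : ℝ :=
  (x - k) * stdGaussCdf (dBac x k σ τ) + stdGaussPdf (dBac x k σ τ) * σ * Real.sqrt τ

lemma stdGaussPdf_nonneg (z : ℝ) : 0 ≤ stdGaussPdf z := by
  unfold stdGaussPdf; positivity

lemma stdGaussPdf_le (z : ℝ) : stdGaussPdf z ≤ 1 / Real.sqrt (2 * Real.pi) := by
  unfold stdGaussPdf
  gcongr
  rw [Real.exp_le_one_iff]
  nlinarith [sq_nonneg z]

lemma stdGaussPdf_eq : stdGaussPdf = ProbabilityTheory.gaussianPDFReal 0 1 := by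
  ext z
  simp [stdGaussPdf, ProbabilityTheory.gaussianPDFReal]
  ring

lemma stdGaussPdf_integrable : Integrable stdGaussPdf := by
  rw [stdGaussPdf_eq]; exact ProbabilityTheory.integrable_gaussianPDFReal 0 1

lemma stdGaussPdf_continuous : Continuous stdGaussPdf := by
  unfold stdGaussPdf; fun_prop

lemma stdGaussCdf_nonneg (z : ℝ) : 0 ≤ stdGaussCdf z :=
  integral_nonneg fun _ => stdGaussPdf_nonneg _

lemma stdGaussCdf_le_one (z : ℝ) : stdGaussCdf z ≤ 1 := by
  have h := ProbabilityTheory.integral_gaussianPDFReal_eq_one 0 (one_ne_zero (α := NNReal))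
  rw [← stdGaussPdf_eq] at h
  rw [← h]
  exact setIntegral_le_integral stdGaussPdf_integrable (ae_of_all _ stdGaussPdf_nonneg)

lemma stdGaussCdf_hasDerivAt (z : ℝ) : HasDerivAt stdGaussCdf (stdGaussPdf z) z := by
  have h : stdGaussCdf = fun w => stdGaussCdf 0 + ∫ u in (0:ℝ)..w, stdGaussPdf u := by
    ext w
    rw [← intervalIntegral.integral_Iic_sub_Iic stdGaussPdf_integrable.integrableOn
      stdGaussPdf_integrable.integrableOn]
    simp [stdGaussCdf]
  rw [h]
  exact (intervalIntegral.integral_hasDerivAt_right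
    (stdGaussPdf_continuous.intervalIntegrable _ _)
    (stdGaussPdf_continuous.stronglyMeasurableAtFilter _ _)
    stdGaussPdf_continuous.continuousAt).const_add _

lemma stdGaussPdf_hasDerivAt (z : ℝ) : HasDerivAt stdGaussPdf (-z * stdGaussPdf z) z := by
  have h : HasDerivAt (fun z : ℝ => -(z ^ 2) / 2) (-z) z := by
    refine ((hasDerivAt_pow 2 z).neg.div_const 2).congr_deriv ?_
    simp
    ring
  refine (h.exp.div_const (Real.sqrt (2 * Real.pi))).congr_deriv ?_
  unfold stdGaussPdf
  ring

lemma stdGaussCdf_mono : Monotone stdGaussCdf :=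
  monotone_of_hasDerivAt_nonneg stdGaussCdf_hasDerivAt stdGaussPdf_nonneg

lemma stdGaussCdf_lip : Monotone (fun z => 1 / Real.sqrt (2 * Real.pi) * z - stdGaussCdf z) :=
  monotone_of_hasDerivAt_nonneg
    (fun z => ((hasDerivAt_id z).const_mul (1 / Real.sqrt (2 * Real.pi))).sub
      (stdGaussCdf_hasDerivAt z))
    (fun z => by have := stdGaussPdf_le z; simp at this ⊢; linarith)

lemma Bac_hasDerivAt (τ x k σ : ℝ) (hτ : 0 < τ) (hσ : 0 < σ) :
    HasDerivAt (fun x => Bac τ x k σ) (stdGaussCdf (dBac x k σ τ)) x := by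
  have hs : 0 < σ * Real.sqrt τ := by positivity
  have hd : HasDerivAt (fun x => dBac x k σ τ) (1 / (σ * Real.sqrt τ)) x :=
    ((hasDerivAt_id x).sub_const k).div_const _
  have h1 := (stdGaussCdf_hasDerivAt (dBac x k σ τ)).comp x hd
  have h2 := (stdGaussPdf_hasDerivAt (dBac x k σ τ)).comp x hd
  have h3 := (((hasDerivAt_id x).sub_const k).mul h1).add
    ((h2.mul_const σ).mul_const (Real.sqrt τ))
  refine h3.congr_deriv ?_
  have : dBac x k σ τ = (x - k) / (σ * Real.sqrt τ) := rfl
  simp only [Function.comp, id]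
  generalize stdGaussPdf (dBac x k σ τ) = p
  rw [this]
  have := Real.sqrt_pos.2 hτ
  field_simp
  ring

lemma nonneg_of_sign_deriv {H H' : ℝ → ℝ} (hd : ∀ y, HasDerivAt H (H' y) y) (h0 : H 0 = 0)
    (hp : ∀ y, 0 ≤ y → 0 ≤ H' y) (hn : ∀ y, y ≤ 0 → H' y ≤ 0) (y : ℝ) : 0 ≤ H y := by
  have hc : Continuous H := continuous_iff_continuousAt.2 fun y => (hd y).continuousAt
  rcases le_total 0 y with hy | hy
  · have := monotoneOn_of_deriv_nonneg (convex_Ici (0:ℝ)) hc.continuousOn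
      (fun z _ => (hd z).differentiableAt.differentiableWithinAt)
      (fun z hz => by
        rw [(hd z).deriv]; exact hp z (interior_subset hz))
    have h := this (self_mem_Ici) hy hy
    rwa [h0] at h
  · have := antitoneOn_of_deriv_nonpos (convex_Iic (0:ℝ)) hc.continuousOn
      (fun z _ => (hd z).differentiableAt.differentiableWithinAt)
      (fun z hz => by
        rw [(hd z).deriv]; exact hn z (mem_Iic.1 (interior_subset hz)))
    have h := this hy (self_mem_Iic) hy
    rwa [h0] at h

/-- If ν is a measure on ℝ with `∫_{|y|<1} y² ν(dy) < ∞` and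
`∫_{|y|≥1} |y| ν(dy) < ∞` (a Lévy-type measure), then the second-order increment
`y ↦ Bac(τ, x+y, k, σ) − Bac(τ, x, k, σ) − y·Φ(d)` is ν-integrable and the
ν-integral of its absolute value is bounded by
`(1/(2√(2π)σ√τ))·∫_{|y|<1} y² ν(dy) + 2·∫_{|y|≥1} |y| ν(dy)`. -/
theorem bachelier_increment_levy_integrable (ν : Measure ℝ)
    (hν₁ : IntegrableOn (fun y => y ^ 2) {y : ℝ | |y| < 1} ν)
    (hν₂ : IntegrableOn (fun y => |y|) {y : ℝ | 1 ≤ |y|} ν)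
    (τ σ x k : ℝ) (hτ : 0 < τ) (hσ : 0 < σ) :
    Integrable (fun y => Bac τ (x + y) k σ - Bac τ x k σ - y * stdGaussCdf (dBac x k σ τ)) ν ∧
    (∫ y, |Bac τ (x + y) k σ - Bac τ x k σ - y * stdGaussCdf (dBac x k σ τ)| ∂ν)
      ≤ (1 / (2 * Real.sqrt (2 * Real.pi) * σ * Real.sqrt τ))
          * (∫ y in {y : ℝ | |y| < 1}, y ^ 2 ∂ν)
        + 2 * ∫ y in {y : ℝ | 1 ≤ |y|}, |y| ∂ν := by
  have hs : 0 < σ * Real.sqrt τ := by positivity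
  have hq : 0 < Real.sqrt (2 * Real.pi) := by positivity
  set F : ℝ → ℝ := fun y =>
    Bac τ (x + y) k σ - Bac τ x k σ - y * stdGaussCdf (dBac x k σ τ) with hF
  set C : ℝ := 1 / (2 * Real.sqrt (2 * Real.pi) * σ * Real.sqrt τ) with hC
  have hFd : ∀ y, HasDerivAt F
      (stdGaussCdf (dBac (x + y) k σ τ) - stdGaussCdf (dBac x k σ τ)) y := by
    intro y
    have h1 := (Bac_hasDerivAt τ (x + y) k σ hτ hσ).comp_const_add x y
    have h2 := (h1.sub_const (Bac τ x k σ)).sub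
      ((hasDerivAt_id y).mul_const (stdGaussCdf (dBac x k σ τ)))
    exact h2.congr_deriv (by simp)
  have hF0 : F 0 = 0 := by simp [hF]
  have hdm : ∀ a b : ℝ, a ≤ b → dBac a k σ τ ≤ dBac b k σ τ := by
    intro a b hab
    unfold dBac
    gcongr
  have hFnn : ∀ y, 0 ≤ F y := by
    refine nonneg_of_sign_deriv hFd hF0 (fun y hy => ?_) (fun y hy => ?_)
    · have := stdGaussCdf_mono (hdm x (x + y) (by linarith)); linarith
    · have := stdGaussCdf_mono (hdm (x + y) x (by linarith)); linarith
  have hdd : ∀ y, 1 / Real.sqrt (2 * Real.pi) * dBac (x + y) k σ τ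
      - 1 / Real.sqrt (2 * Real.pi) * dBac x k σ τ = C * (2 * y) := by
    intro y
    have := Real.sqrt_pos.2 hτ
    simp only [dBac, hC]
    field_simp
    ring
  have hFsq : ∀ y, F y ≤ C * y ^ 2 := by
    intro y
    have := nonneg_of_sign_deriv (H := fun y => C * y ^ 2 - F y)
      (fun y => (((hasDerivAt_pow 2 y).const_mul C).sub (hFd y))) (by simp [hF0])
      (fun y hy => by
        have := stdGaussCdf_lip (hdm x (x + y) (by linarith))
        have h2 := hdd y
        simp only [Nat.cast_ofNat, Nat.add_one_sub_one, pow_one] at *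
        linarith)
      (fun y hy => by
        have := stdGaussCdf_lip (hdm (x + y) x (by linarith))
        have h2 := hdd y
        simp only [Nat.cast_ofNat, Nat.add_one_sub_one, pow_one] at *
        linarith) y
    linarith
  have hFlin : ∀ y, F y ≤ 2 * |y| := by
    intro y
    have h := convex_univ.norm_image_sub_le_of_norm_hasDerivWithin_le (𝕜 := ℝ) (C := 1)
      (fun z _ => (hFd z).hasDerivWithinAt) (fun z _ => by
        have := stdGaussCdf_nonneg (dBac (x + z) k σ τ)
        have := stdGaussCdf_nonneg (dBac x k σ τ)
        have := stdGaussCdf_le_one (dBac (x + z) k σ τ)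
        have := stdGaussCdf_le_one (dBac x k σ τ)
        rw [Real.norm_eq_abs, abs_le]; constructor <;> linarith)
      (mem_univ 0) (mem_univ y)
    rw [hF0, sub_zero, sub_zero, Real.norm_eq_abs, Real.norm_eq_abs] at h
    have := le_abs_self (F y)
    have := abs_nonneg y
    linarith
  have hFc : Continuous F := continuous_iff_continuousAt.2 fun y => (hFd y).continuousAt
  have hA : MeasurableSet {y : ℝ | |y| < 1} := measurableSet_lt (by fun_prop) (by fun_prop)
  have hAc : {y : ℝ | |y| < 1}ᶜ = {y : ℝ | 1 ≤ |y|} := by ext y; simp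
  have hi1 : IntegrableOn F {y : ℝ | |y| < 1} ν :=
    (hν₁.const_mul C).mono' hFc.measurable.aestronglyMeasurable (ae_of_all _ fun y => by
      rw [Real.norm_of_nonneg (hFnn y)]; exact hFsq y)
  have hi2 : IntegrableOn F {y : ℝ | 1 ≤ |y|} ν :=
    (hν₂.const_mul 2).mono' hFc.measurable.aestronglyMeasurable (ae_of_all _ fun y => by
      rw [Real.norm_of_nonneg (hFnn y)]; exact hFlin y)
  have hi : Integrable F ν := by
    rw [← integrableOn_univ, ← union_compl_self {y : ℝ | |y| < 1}, hAc]
    exact hi1.union hi2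
  refine ⟨hi, ?_⟩
  have habs : ∀ y, |F y| = F y := fun y => abs_of_nonneg (hFnn y)
  change ∫ y, |F y| ∂ν ≤ _
  simp_rw [habs]
  rw [← integral_add_compl hA hi, hAc, ← integral_const_mul, ← integral_const_mul]
  exact add_le_add (integral_mono hi1 (hν₁.const_mul C) hFsq)
    (integral_mono hi2 (hν₂.const_mul 2) hFlin)
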